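/- Let P be a Markov kernel over a Polish space X with metric d that admits an ergodic invariant probability measure μ★. Assume there exist a measurable set B ⊆ X with μ★(B) > 1/2 and a point x₀ ∈ X such that for every neighbourhood U of x₀ there exists k > 0 with inf_{y ∈ B} P^k(y, U) > 0. Assume furthermore that there exists a measurable map (y,y') ↦ Γ_{y,y'} with Γ_{y,y'} ∈ C(P_[∞]δ_y, P_[∞]δ_{y'}) for every (y,y'), such that for every ε > 0 and every x ∈ X there exists a neighbourhood U of x with inf_{y,y' ∈ U} Γ_{y,y'}(D) ≥ 1 − ε. Then Pⁿ(z,·) converges weakly to μ★ as n → ∞ for every z in the support of μ★. -/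

import Mathlib

open MeasureTheory ProbabilityTheory Filter Topology BoundedContinuousFunction
open scoped ENNReal NNReal

noncomputable section

/-- A coupling of two measures: a measure on the product with the given marginals. -/
def IsCoupling {α β : Type*} [MeasurableSpace α] [MeasurableSpace β]
    (π : Measure (α × β)) (μ : Measure α) (ν : Measure β) : Prop :=
  π.map Prod.fst = μ ∧ π.map Prod.snd = ν

/-- `m` is the law on the sequence space of the Markov chain with transition kernel `P`
and initial distribution `μ` (i.e. `P_[∞] μ`), characterised through its
finite-dimensional distributions. -/
def IsTrajLaw {Y : Type*} [MeasurableSpace Y] (P : Kernel Y Y) (μ : Measure Y)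
    (m : Measure (ℕ → Y)) : Prop :=
  IsProbabilityMeasure m ∧
  m.map (fun ω => ω 0) = μ ∧
  ∀ n : ℕ, m.map (fun ω => ((fun i : Fin (n + 1) => ω i), ω (n + 1))) =
    (m.map (fun ω => (fun i : Fin (n + 1) => ω i))).bind
      (fun v => (P (v (Fin.last n))).map (fun y => (v, y)))

/-- The diagonal at infinity: pairs of sequences that converge to each other. -/
def diagInf (X : Type*) [PseudoMetricSpace X] : Set ((ℕ → X) × (ℕ → X)) :=
  {p | Tendsto (fun n => dist (p.1 n) (p.2 n)) atTop (nhds 0)}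

/-- The `n`-step transition kernel `P^n`. -/
def kIter {X : Type*} [MeasurableSpace X] (P : Kernel X X) : ℕ → Kernel X X
  | 0 => Kernel.id
  | n + 1 => (kIter P n) ∘ₖ P

/-- `μ` is an ergodic invariant probability measure for the Markov kernel `P`. -/
def IsErgodicInvariant {Y : Type*} [MeasurableSpace Y] (P : Kernel Y Y) (μ : Measure Y) :
    Prop :=
  μ.bind (fun x => P x) = μ ∧
  ∀ φ : Y → ℝ, Measurable φ → (∃ M, ∀ x, |φ x| ≤ M) →
    (∀ᵐ x ∂μ, ∫ y, φ y ∂(P x) = φ x) → ∃ c : ℝ, ∀ᵐ x ∂μ, φ x = c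

theorem limsup_enorm_integral_le {Ω : Type*} [MeasurableSpace Ω] (π : Measure Ω)
    [IsFiniteMeasure π] {g : ℕ → Ω → ℝ} (hg : ∀ n, Measurable (g n)) {C : ℝ}
    (hC : ∀ n ω, |g n ω| ≤ C) :
    limsup (fun n => ‖∫ ω, g n ω ∂π‖ₑ) atTop ≤ ∫⁻ ω, limsup (fun n => ‖g n ω‖ₑ) atTop ∂π := by
  refine (limsup_le_limsup (Eventually.of_forall fun n =>
    enorm_integral_le_lintegral_enorm (g n))).trans ?_
  refine limsup_lintegral_le (fun _ => ENNReal.ofReal C) (fun n => (hg n).enorm)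
    (fun n => Eventually.of_forall fun ω => ?_) ?_
  · simp only [Real.enorm_eq_ofReal_abs]
    exact ENNReal.ofReal_le_ofReal (hC n ω)
  · simp [ENNReal.mul_eq_top]

theorem limsup_enorm_integral_sub_integral_le {X : Type*} [MeasurableSpace X]
    (ν ν' : Measure X) [IsProbabilityMeasure ν] [IsProbabilityMeasure ν'] {f : ℕ → X → ℝ}
    (hf : ∀ n, Measurable (f n)) {C : ℝ} (hC : ∀ n x, |f n x| ≤ C) :
    limsup (fun n => ‖∫ y, f n y ∂ν - ∫ y, f n y ∂ν'‖ₑ) atTop ≤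
      ∫⁻ p, limsup (fun n => ‖f n p.1 - f n p.2‖ₑ) atTop ∂(ν.prod ν') := by
  have key : ∀ n, ∫ y, f n y ∂ν - ∫ y, f n y ∂ν' =
      ∫ p : X × X, (f n p.1 - f n p.2) ∂(ν.prod ν') := by
    intro n
    rw [integral_sub, integral_fun_fst, integral_fun_snd]
    · simp
    · exact Integrable.of_bound ((hf n).comp measurable_fst).aestronglyMeasurable C
        (Eventually.of_forall fun p => hC n p.1)
    · exact Integrable.of_bound ((hf n).comp measurable_snd).aestronglyMeasurable C
        (Eventually.of_forall fun p => hC n p.2)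
  simp_rw [key]
  refine limsup_enorm_integral_le (ν.prod ν') (C := C + C)
    (fun n => ((hf n).comp measurable_fst).sub ((hf n).comp measurable_snd)) fun n p => ?_
  exact (abs_sub _ _).trans (add_le_add (hC n p.1) (hC n p.2))

instance isMarkovKernel_kIter {X : Type*} [MeasurableSpace X] (P : Kernel X X)
    [IsMarkovKernel P] (n : ℕ) : IsMarkovKernel (kIter P n) := by
  induction n with
  | zero => exact inferInstanceAs (IsMarkovKernel Kernel.id)
  | succ n ih => exact inferInstanceAs (IsMarkovKernel ((kIter P n) ∘ₖ P))

theorem kIter_add {X : Type*} [MeasurableSpace X] (P : Kernel X X) (n k : ℕ) :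
    kIter P (n + k) = (kIter P n) ∘ₖ (kIter P k) := by
  induction k with
  | zero => exact (Kernel.comp_id _).symm
  | succ k ih =>
    change (kIter P (n + k)) ∘ₖ P = (kIter P n) ∘ₖ ((kIter P k) ∘ₖ P)
    rw [ih, Kernel.comp_assoc]

theorem kIter_one {X : Type*} [MeasurableSpace X] (P : Kernel X X) : kIter P 1 = P :=
  Kernel.id_comp P

theorem bind_kIter_of_invariant {X : Type*} [MeasurableSpace X] {P : Kernel X X}
    {μ : Measure X} (h : μ.bind P = μ) (n : ℕ) : μ.bind (kIter P n) = μ := by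
  induction n with
  | zero => exact Measure.id_comp
  | succ n ih =>
    change μ.bind ((kIter P n) ∘ₖ P) = μ
    rw [← Measure.comp_assoc, h, ih]

theorem bind_parallelComp_prod {X : Type*} [MeasurableSpace X] {κ : Kernel X X}
    [IsMarkovKernel κ] {μ : Measure X} [IsProbabilityMeasure μ] (h : μ.bind κ = μ) :
    (μ.prod μ).bind (κ ∥ₖ κ) = μ.prod μ := by
  have h1 := Measure.prod_comp_left (μ := μ) (ν := μ) (κ := κ)
  have h2 := Measure.prod_comp_right (μ := μ) (ν := μ) (κ := κ)
  rw [h] at h1 h2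
  have hκ : κ ∥ₖ κ = (κ ∥ₖ Kernel.id) ∘ₖ (Kernel.id ∥ₖ κ) := by
    rw [Kernel.parallelComp_comp_parallelComp, Kernel.comp_id, Kernel.id_comp]
  rw [hκ, ← Measure.comp_assoc, ← h2, ← h1]

theorem IsTrajLaw.map_eval {Y : Type*} [MeasurableSpace Y] {P : Kernel Y Y} [IsMarkovKernel P]
    {y : Y} {m : Measure (ℕ → Y)} (hm : IsTrajLaw P (Measure.dirac y) m) (n : ℕ) :
    m.map (fun ω => ω n) = kIter P n y := by
  induction n with
  | zero => exact hm.2.1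
  | succ n ih =>
    have h := congrArg (Measure.map Prod.snd) (hm.2.2 n)
    have hv : Measurable fun ω : ℕ → Y => fun i : Fin (n + 1) => ω i := by fun_prop
    rw [Measure.map_map measurable_snd (by fun_prop)] at h
    change m.map (fun ω => ω (n + 1)) = _ at h
    have hstep : kIter P (n + 1) y = (m.map fun ω => ω n).bind P := by
      rw [add_comm n 1, kIter_add, kIter_one, Kernel.comp_apply, ← ih]
    rw [h, hstep]
    have hk : Measurable fun v : Fin (n + 1) → Y =>
        (P (v (Fin.last n))).map (fun y => (v, y)) := by
      convert (Kernel.id ×ₖ P.comap (fun v : Fin (n + 1) → Y => v (Fin.last n))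
        (measurable_pi_apply _)).measurable using 2 with v
      rw [Kernel.prod_apply, Kernel.id_apply, Kernel.comap_apply, Measure.dirac_prod]
    ext s hs
    rw [Measure.map_apply measurable_snd hs,
      Measure.bind_apply (measurable_snd hs) hk.aemeasurable,
      Measure.bind_apply hs P.measurable.aemeasurable,
      lintegral_map (Measure.measurable_measure.1 hk _ (measurable_snd hs)) hv,
      lintegral_map (P.measurable_coe hs) (measurable_pi_apply n)]
    refine lintegral_congr fun ω => ?_
    rw [Measure.map_apply measurable_prodMk_left (measurable_snd hs)]
    simp [Set.preimage_preimage]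

theorem IsErgodicInvariant.ae_eq_lintegral_of_le {X : Type*} [MeasurableSpace X]
    {P : Kernel X X} [IsMarkovKernel P] {μ : Measure X} [IsProbabilityMeasure μ]
    (h : IsErgodicInvariant P μ) {g : X → ℝ≥0∞} (hg : Measurable g) {C : ℝ≥0∞} (hC : C ≠ ∞)
    (hgC : ∀ x, g x ≤ C) (hsub : ∀ x, g x ≤ ∫⁻ y, g y ∂(P x)) :
    ∀ᵐ x ∂μ, g x = ∫⁻ y, g y ∂μ := by
  have hint : ∫⁻ x, ∫⁻ y, g y ∂(P x) ∂μ = ∫⁻ x, g x ∂μ := by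
    rw [← Measure.lintegral_bind P.measurable.aemeasurable hg.aemeasurable, h.1]
  have hfin : ∫⁻ x, g x ∂μ ≠ ∞ :=
    ((lintegral_mono hgC).trans_lt (by simpa using hC.lt_top)).ne
  have hae : g =ᵐ[μ] fun x => ∫⁻ y, g y ∂(P x) :=
    ae_eq_of_ae_le_of_lintegral_le (Eventually.of_forall hsub) hfin
      hg.lintegral_kernel.aemeasurable hint.le
  have hlt : ∀ x, g x < ∞ := fun x => (hgC x).trans_lt hC.lt_top
  obtain ⟨c, hc⟩ := h.2 (fun x => (g x).toReal) hg.ennreal_toReal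
    ⟨C.toReal, fun x => by
      rw [abs_of_nonneg ENNReal.toReal_nonneg]
      exact ENNReal.toReal_mono hC (hgC x)⟩ (by
      filter_upwards [hae] with x hx
      rw [integral_toReal hg.aemeasurable (Eventually.of_forall hlt), ← hx])
  have hc' : ∀ᵐ x ∂μ, g x = ENNReal.ofReal c := by
    filter_upwards [hc] with x hx
    rw [← hx, ENNReal.ofReal_toReal (hlt x).ne]
  have : ∫⁻ y, g y ∂μ = ENNReal.ofReal c := by
    rw [lintegral_congr_ae hc']; simp
  rwa [this]

theorem IsErgodicInvariant.ae_lintegral_eq_lintegral_prod {X : Type*} [MeasurableSpace X]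
    {P : Kernel X X} [IsMarkovKernel P] {μ : Measure X} [IsProbabilityMeasure μ]
    (h : IsErgodicInvariant P μ) {u : X × X → ℝ≥0∞} (hu : Measurable u) {C : ℝ≥0∞}
    (hC : C ≠ ∞) (huC : ∀ p, u p ≤ C) (hsub : ∀ p, u p ≤ ∫⁻ q, u q ∂((P ∥ₖ P) p)) :
    ∀ᵐ y ∂μ, ∫⁻ y', u (y, y') ∂μ = ∫⁻ p, u p ∂(μ.prod μ) := by
  rw [lintegral_prod _ hu.aemeasurable]
  refine h.ae_eq_lintegral_of_le hu.lintegral_prod_right' hC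
    (fun y => (lintegral_mono fun y' => huC (y, y')).trans (by simp)) fun y => ?_
  calc ∫⁻ y', u (y, y') ∂μ ≤ ∫⁻ y', ∫⁻ w', ∫⁻ w, u (w, w') ∂(P y) ∂(P y') ∂μ := by
        refine lintegral_mono fun y' => (hsub (y, y')).trans ?_
        rw [Kernel.lintegral_parallelComp_symm _ hu]
    _ = ∫⁻ w', ∫⁻ w, u (w, w') ∂(P y) ∂μ := by
        have hm : Measurable fun w' => ∫⁻ w, u (w, w') ∂(P y) := hu.lintegral_prod_left'
        rw [← Measure.lintegral_bind P.measurable.aemeasurable hm.aemeasurable, h.1]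
    _ = ∫⁻ w, ∫⁻ w', u (w, w') ∂μ ∂(P y) :=
        lintegral_lintegral_swap (hu.comp measurable_swap).aemeasurable

theorem IsErgodicInvariant.ae_eq_zero_of_ae_eq_zero_on {X : Type*} [MeasurableSpace X]
    {P : Kernel X X} [IsMarkovKernel P] {μ : Measure X} [IsProbabilityMeasure μ]
    (h : IsErgodicInvariant P μ) {B : Set X} (hBm : MeasurableSet B) (hB : 1 / 2 < μ B)
    {u : X × X → ℝ≥0∞} (hu : Measurable u) {C : ℝ≥0∞}
    (hC : C ≠ ∞) (huC : ∀ p, u p ≤ C) (hsub : ∀ p, u p ≤ ∫⁻ q, u q ∂((P ∥ₖ P) p))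
    (huB : ∀ᵐ p ∂(μ.prod μ), p ∈ B ×ˢ B → u p = 0) :
    ∀ᵐ p ∂(μ.prod μ), u p = 0 := by
  have hleft := h.ae_lintegral_eq_lintegral_prod hu hC huC hsub
  have hright := h.ae_lintegral_eq_lintegral_prod (hu.comp measurable_swap) hC
    (fun p => huC p.swap) (fun p => (hsub p.swap).trans (by
      rw [Kernel.lintegral_parallelComp _ hu,
        Kernel.lintegral_parallelComp_symm _ (hu.comp measurable_swap)]
      rfl))
  have hswap : ∫⁻ p, (u ∘ Prod.swap) p ∂(μ.prod μ) = ∫⁻ p, u p ∂(μ.prod μ) := by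
    exact lintegral_prod_swap u
  rw [hswap] at hright
  set I := ∫⁻ p, u p ∂(μ.prod μ) with hI
  have hIfin : I ≠ ∞ := ((lintegral_mono huC).trans_lt (by simpa using hC.lt_top)).ne
  have hBc : μ Bᶜ + μ Bᶜ < 1 := by
    have h1 : μ Bᶜ < 1 / 2 := by
      rw [prob_compl_eq_one_sub hBm]
      refine ENNReal.sub_lt_of_lt_add prob_le_one ?_
      calc (1 : ℝ≥0∞) = 1 / 2 + 1 / 2 := (ENNReal.add_halves 1).symm
        _ < 1 / 2 + μ B := ENNReal.add_lt_add_left (by simp) hB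
    calc μ Bᶜ + μ Bᶜ < 1 / 2 + 1 / 2 := ENNReal.add_lt_add h1 h1
      _ = 1 := ENNReal.add_halves 1
  have h1 : ∫⁻ p in Bᶜ ×ˢ Set.univ, u p ∂(μ.prod μ) = I * μ Bᶜ := by
    rw [setLIntegral_prod _ hu.aemeasurable, Measure.restrict_univ,
      lintegral_congr_ae (ae_restrict_of_ae hleft)]
    simp
  have h2 : ∫⁻ p in Set.univ ×ˢ Bᶜ, u p ∂(μ.prod μ) = I * μ Bᶜ := by
    rw [setLIntegral_prod_symm _ hu.aemeasurable, Measure.restrict_univ]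
    have := lintegral_congr_ae (ae_restrict_of_ae (s := Bᶜ) hright)
    simp only [Function.comp_apply, Prod.swap_prod_mk] at this
    rw [this]
    simp
  have h3 : ∫⁻ p in B ×ˢ B, u p ∂(μ.prod μ) = 0 := by
    rw [← lintegral_zero (μ := (μ.prod μ).restrict (B ×ˢ B))]
    exact lintegral_congr_ae ((ae_restrict_iff' (hBm.prod hBm)).2 huB)
  have hle : I ≤ I * (μ Bᶜ + μ Bᶜ) := by
    have hcover : (Set.univ : Set (X × X)) = (Bᶜ ×ˢ Set.univ ∪ Set.univ ×ˢ Bᶜ) ∪ B ×ˢ B := by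
      ext p; simp; tauto
    calc I = ∫⁻ p in Set.univ, u p ∂(μ.prod μ) := by rw [Measure.restrict_univ]
      _ ≤ I * μ Bᶜ + I * μ Bᶜ + 0 := by
        rw [hcover]
        refine (lintegral_union_le _ _ _).trans ?_
        rw [h3]
        gcongr
        refine (lintegral_union_le _ _ _).trans ?_
        rw [h1, h2]
      _ = I * (μ Bᶜ + μ Bᶜ) := by ring
  have hzero : I = 0 := by
    by_contra hne
    have := ENNReal.mul_lt_mul_right hne hIfin hBc
    rw [mul_one] at this
    exact absurd hle this.not_ge
  exact (lintegral_eq_zero_iff hu).1 hzero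

theorem IsErgodicInvariant.ae_le_of_le_on {X : Type*} [MeasurableSpace X]
    {P : Kernel X X} [IsMarkovKernel P] {μ : Measure X} [IsProbabilityMeasure μ]
    (h : IsErgodicInvariant P μ) {B : Set X} (hBm : MeasurableSet B) (hB : 1 / 2 < μ B)
    {u : X × X → ℝ≥0∞} (hu : Measurable u) {C : ℝ≥0∞}
    (hC : C ≠ ∞) (huC : ∀ p, u p ≤ C)
    (hsub : ∀ k p, u p ≤ ∫⁻ q, u q ∂((kIter P k ∥ₖ kIter P k) p))
    {S : Set (X × X)} (hS : MeasurableSet S) {k : ℕ} {δ ε : ℝ≥0∞} (hδ : 0 < δ)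
    (hSk : ∀ p ∈ B ×ˢ B, δ ≤ (kIter P k ∥ₖ kIter P k) p S) (huS : ∀ p ∈ S, u p ≤ ε) :
    ∀ᵐ p ∂(μ.prod μ), u p ≤ ε := by
  have step : ∀ D : ℝ≥0∞, (∀ᵐ p ∂(μ.prod μ), u p ≤ ε + D) →
      ∀ᵐ p ∂(μ.prod μ), u p ≤ ε + D * (1 - δ) := by
    intro D hD
    have hDk : ∀ᵐ p ∂(μ.prod μ), ∀ᵐ q ∂((kIter P k ∥ₖ kIter P k) p), u q ≤ ε + D := by
      refine Measure.ae_ae_of_ae_comp ?_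
      rwa [bind_parallelComp_prod (bind_kIter_of_invariant h.1 k)]
    have hv := h.ae_eq_zero_of_ae_eq_zero_on hBm hB (u := fun p => u p - (ε + D * (1 - δ)))
      (hu.sub_const _) hC (fun p => tsub_le_self.trans (huC p)) (fun p => by
        refine le_trans ?_ (lintegral_sub_le _ _ measurable_const)
        have := hsub 1 p
        rw [kIter_one] at this
        simpa using tsub_le_tsub_right this _) (by
        filter_upwards [hDk] with p hp hpB
        refine tsub_eq_zero_of_le ((hsub k p).trans ?_)
        calc ∫⁻ q, u q ∂((kIter P k ∥ₖ kIter P k) p)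
            ≤ ∫⁻ q, (ε + Sᶜ.indicator (fun _ => D) q) ∂((kIter P k ∥ₖ kIter P k) p) := by
              refine lintegral_mono_ae ?_
              filter_upwards [hp] with q hq
              by_cases hqS : q ∈ S
              · simpa [hqS] using huS q hqS
              · simpa [hqS] using hq
          _ = ε + D * (kIter P k ∥ₖ kIter P k) p Sᶜ := by
              rw [lintegral_add_left measurable_const, lintegral_indicator_const hS.compl]
              simp
          _ ≤ ε + D * (1 - δ) := by
              rw [prob_compl_eq_one_sub hS]
              gcongr
              exact hSk p hpB)
    filter_upwards [hv] with p hp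
    exact tsub_eq_zero_iff_le.1 hp
  have hiter : ∀ n : ℕ, ∀ᵐ p ∂(μ.prod μ), u p ≤ ε + C * (1 - δ) ^ n := by
    intro n
    induction n with
    | zero => exact Eventually.of_forall fun p => (huC p).trans (by simp)
    | succ n ih => simpa [pow_succ, mul_assoc] using step _ ih
  have hlim : Tendsto (fun n : ℕ => ε + C * (1 - δ) ^ n) atTop (𝓝 ε) := by
    have h0 := ENNReal.tendsto_pow_atTop_nhds_zero_of_lt_one
      (ENNReal.sub_lt_self ENNReal.one_ne_top one_ne_zero hδ.ne')
    simpa using (ENNReal.Tendsto.const_mul h0 (Or.inr hC)).const_add ε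
  filter_upwards [ae_all_iff.2 hiter] with p hp
  exact ge_of_tendsto' hlim hp

/-- The asymptotic distance between the `φ`-averages of the chain from two starting points. -/
def asympDist {X : Type*} [MeasurableSpace X] (P : Kernel X X) (φ : X → ℝ) (p : X × X) : ℝ≥0∞ :=
  limsup (fun n => ‖∫ y, φ y ∂(kIter P n p.1) - ∫ y, φ y ∂(kIter P n p.2)‖ₑ) atTop

section AsympDist

variable {X : Type*} [MeasurableSpace X] {P : Kernel X X} {φ : X → ℝ}

theorem measurable_integral_kIter (hφ : Measurable φ) (n : ℕ) :
    Measurable fun x => ∫ y, φ y ∂(kIter P n x) :=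
  hφ.stronglyMeasurable.integral_kernel.measurable

theorem abs_integral_le_of_abs_le {ν : Measure X} [IsProbabilityMeasure ν] {C : ℝ}
    (hC : ∀ x, |φ x| ≤ C) : |∫ y, φ y ∂ν| ≤ C := by
  simpa using norm_integral_le_of_norm_le_const (μ := ν) (f := φ) (C := C)
    (Eventually.of_forall hC)

theorem integral_bind_kernel (hφ : Measurable φ) {C : ℝ} (hC : ∀ x, |φ x| ≤ C)
    (κ : Kernel X X) [IsMarkovKernel κ] (ν : Measure X) [IsProbabilityMeasure ν] :
    ∫ y, φ y ∂(ν.bind κ) = ∫ x, ∫ y, φ y ∂(κ x) ∂ν := by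
  rw [Measure.comp_eq_comp_const_apply, Kernel.integral_comp, Kernel.const_apply]
  exact Integrable.of_bound hφ.aestronglyMeasurable C (Eventually.of_forall hC)

theorem measurable_asympDist (hφ : Measurable φ) : Measurable (asympDist P φ) :=
  Measurable.limsup fun n => (((measurable_integral_kIter hφ n).comp measurable_fst).sub
    ((measurable_integral_kIter hφ n).comp measurable_snd)).enorm

theorem asympDist_le [IsMarkovKernel P] {C : ℝ} (hC : ∀ x, |φ x| ≤ C) (p : X × X) :
    asympDist P φ p ≤ ENNReal.ofReal (C + C) := by
  refine limsup_le_of_le (by isBoundedDefault) (Eventually.of_forall fun n => ?_)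
  rw [Real.enorm_eq_ofReal_abs]
  exact ENNReal.ofReal_le_ofReal ((abs_sub _ _).trans
    (add_le_add (abs_integral_le_of_abs_le hC) (abs_integral_le_of_abs_le hC)))

theorem limsup_enorm_bind_kIter_le [IsMarkovKernel P] (hφ : Measurable φ) {C : ℝ} (hC : ∀ x, |φ x| ≤ C)
    (ν ν' : Measure X) [IsProbabilityMeasure ν] [IsProbabilityMeasure ν'] :
    limsup (fun n => ‖∫ y, φ y ∂(ν.bind (kIter P n)) - ∫ y, φ y ∂(ν'.bind (kIter P n))‖ₑ)
      atTop ≤ ∫⁻ p, asympDist P φ p ∂(ν.prod ν') := by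
  simp_rw [integral_bind_kernel hφ hC]
  exact limsup_enorm_integral_sub_integral_le ν ν' (measurable_integral_kIter hφ)
    fun n x => abs_integral_le_of_abs_le hC

theorem asympDist_le_lintegral [IsMarkovKernel P] (hφ : Measurable φ) {C : ℝ} (hC : ∀ x, |φ x| ≤ C) (k : ℕ)
    (p : X × X) :
    asympDist P φ p ≤ ∫⁻ q, asympDist P φ q ∂((kIter P k ∥ₖ kIter P k) p) := by
  rw [Kernel.parallelComp_apply]
  refine le_trans (le_of_eq ?_)
    (limsup_enorm_bind_kIter_le hφ hC (kIter P k p.1) (kIter P k p.2))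
  rw [asympDist, ← limsup_nat_add _ k]
  simp_rw [kIter_add, Kernel.comp_apply]

theorem asympDist_le_of_eq_zero {y z : X} (hyz : asympDist P φ (y, z) = 0) (x : X) :
    asympDist P φ (x, z) ≤ asympDist P φ (x, y) := by
  have h0 := tendsto_of_le_liminf_of_limsup_le bot_le hyz.le
  refine le_trans (limsup_le_limsup (Eventually.of_forall fun n => ?_))
    (ENNReal.limsup_add_of_right_tendsto_zero h0 _).le
  refine le_trans (le_of_eq ?_) (enorm_add_le _ _)
  simp

end AsympDist

theorem asympDist_le_of_coupling {X : Type*} [PseudoMetricSpace X] [MeasurableSpace X]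
    [BorelSpace X] {P : Kernel X X} [IsMarkovKernel P] {φ : X → ℝ} (hφ : UniformContinuous φ)
    {C : ℝ} (hC : ∀ x, |φ x| ≤ C) {y y' : X} {π : Measure ((ℕ → X) × (ℕ → X))}
    (h₁ : IsTrajLaw P (Measure.dirac y) (π.map Prod.fst))
    (h₂ : IsTrajLaw P (Measure.dirac y') (π.map Prod.snd)) {ε : ℝ}
    (hdiag : ENNReal.ofReal (1 - ε) ≤ π (diagInf X)) :
    asympDist P φ (y, y') ≤ ENNReal.ofReal (C + C) * ENNReal.ofReal ε := by
  have hm : Measurable φ := hφ.continuous.measurable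
  have hπ : IsProbabilityMeasure π := ⟨by
    have := h₁.1.measure_univ
    rwa [Measure.map_apply measurable_fst MeasurableSet.univ, Set.preimage_univ] at this⟩
  have hm1 : ∀ n, Measurable fun ω : (ℕ → X) × (ℕ → X) => φ (ω.1 n) := fun n =>
    hm.comp ((measurable_pi_apply n).comp measurable_fst)
  have hm2 : ∀ n, Measurable fun ω : (ℕ → X) × (ℕ → X) => φ (ω.2 n) := fun n =>
    hm.comp ((measurable_pi_apply n).comp measurable_snd)
  have hint : ∀ n, ∫ x, φ x ∂(kIter P n y) - ∫ x, φ x ∂(kIter P n y') =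
      ∫ ω, (φ (ω.1 n) - φ (ω.2 n)) ∂π := by
    intro n
    rw [integral_sub, ← h₁.map_eval, ← h₂.map_eval, Measure.map_map, Measure.map_map,
      integral_map, integral_map]
    · rfl
    any_goals first | exact hm.aestronglyMeasurable | fun_prop
    · exact Integrable.of_bound (hm1 n).aestronglyMeasurable C
        (Eventually.of_forall fun ω => hC _)
    · exact Integrable.of_bound (hm2 n).aestronglyMeasurable C
        (Eventually.of_forall fun ω => hC _)
  have hb : ∀ n (ω : (ℕ → X) × (ℕ → X)), |φ (ω.1 n) - φ (ω.2 n)| ≤ C + C := fun n ω =>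
    (abs_sub _ _).trans (add_le_add (hC _) (hC _))
  set v : (ℕ → X) × (ℕ → X) → ℝ≥0∞ := fun ω =>
    limsup (fun n => ‖φ (ω.1 n) - φ (ω.2 n)‖ₑ) atTop with hv
  have hvm : Measurable v := Measurable.limsup fun n => ((hm1 n).sub (hm2 n)).enorm
  have hvb : ∀ ω, v ω ≤ ENNReal.ofReal (C + C) := fun ω => by
    refine limsup_le_of_le (by isBoundedDefault) (Eventually.of_forall fun n => ?_)
    rw [Real.enorm_eq_ofReal_abs]
    exact ENNReal.ofReal_le_ofReal (hb n ω)
  have hv0 : diagInf X ⊆ v ⁻¹' {0} := by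
    intro ω hω
    have h1 : Tendsto (fun n => (ω.1 n, ω.2 n)) atTop (uniformity X) :=
      tendsto_uniformity_iff_dist_tendsto_zero.2 hω
    have h2 := tendsto_uniformity_iff_dist_tendsto_zero.1 (Tendsto.comp hφ h1)
    refine Tendsto.limsup_eq ?_
    have h3 := ENNReal.tendsto_ofReal h2
    simpa [Real.enorm_eq_ofReal_abs, Real.dist_eq] using h3
  have hA : MeasurableSet (v ⁻¹' {0}) := hvm (measurableSet_singleton 0)
  have hcompl : π (v ⁻¹' {0})ᶜ ≤ ENNReal.ofReal ε := by
    rw [prob_compl_eq_one_sub hA, tsub_le_iff_right]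
    calc (1 : ℝ≥0∞) = ENNReal.ofReal (ε + (1 - ε)) := by simp
      _ ≤ ENNReal.ofReal ε + ENNReal.ofReal (1 - ε) := ENNReal.ofReal_add_le
      _ ≤ ENNReal.ofReal ε + π (v ⁻¹' {0}) := by
        gcongr
        exact hdiag.trans (measure_mono hv0)
  calc asympDist P φ (y, y') ≤ ∫⁻ ω, v ω ∂π := by
        rw [asympDist]
        simp_rw [hint]
        exact limsup_enorm_integral_le π (fun n => (hm1 n).sub (hm2 n)) hb
    _ ≤ ∫⁻ ω, (v ⁻¹' {0})ᶜ.indicator (fun _ => ENNReal.ofReal (C + C)) ω ∂π := by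
        refine lintegral_mono fun ω => ?_
        by_cases hω : v ω = 0
        · simp [hω]
        · simpa [hω] using hvb ω
    _ ≤ ENNReal.ofReal (C + C) * ENNReal.ofReal ε := by
        rw [lintegral_indicator_const hA.compl]
        gcongr



/-- **Theorem 2.4.** Under a recurrence condition on a set `B` of `μ★`-measure `> 1/2`
towards neighbourhoods of a point `x₀`, and a local asymptotic coupling condition,
transition probabilities `Pⁿ(z,·)` converge weakly to the ergodic invariant measure `μ★`
for every `z` in the support of `μ★`. -/
theorem stmt_4 {X : Type*} [MetricSpace X] [CompleteSpace X] [SecondCountableTopology X]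
    [MeasurableSpace X] [BorelSpace X]
    (P : Kernel X X) [IsMarkovKernel P]
    (μstar : Measure X) [IsProbabilityMeasure μstar] (hergodic : IsErgodicInvariant P μstar)
    (B : Set X) (hB_meas : MeasurableSet B) (hB : 1 / 2 < μstar B)
    (x₀ : X)
    (hrec : ∀ U ∈ nhds x₀, ∃ k : ℕ, 0 < k ∧ ∃ c : ℝ≥0∞, 0 < c ∧
      ∀ y ∈ B, c ≤ (kIter P k) y U)
    (Γ : X → X → Measure ((ℕ → X) × (ℕ → X)))
    -- measurability of `(y,y') ↦ Γ_{y,y'}`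
    (hΓ_meas : ∀ φ : ((ℕ → X) × (ℕ → X)) →ᵇ ℝ,
      Measurable (fun p : X × X => ∫ ω, φ ω ∂(Γ p.1 p.2)))
    -- `Γ_{y,y'} ∈ C(P_[∞]δ_y, P_[∞]δ_{y'})`
    (hΓ_cpl : ∀ y y' : X,
      IsTrajLaw P (Measure.dirac y) ((Γ y y').map Prod.fst) ∧
      IsTrajLaw P (Measure.dirac y') ((Γ y y').map Prod.snd))
    (hΓ_diag : ∀ ε : ℝ, 0 < ε → ∀ x : X, ∃ U ∈ nhds x,
      ∀ y ∈ U, ∀ y' ∈ U, ENNReal.ofReal (1 - ε) ≤ Γ y y' (diagInf X)) :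
    ∀ z : X, (∀ U ∈ nhds z, 0 < μstar U) →
      ∀ φ : X →ᵇ ℝ,
        Tendsto (fun n => ∫ y, φ y ∂((kIter P n) z)) atTop (nhds (∫ y, φ y ∂μstar)) := by
  have main : ∀ φ : X → ℝ, UniformContinuous φ → ∀ C : ℝ, 0 ≤ C → (∀ x, |φ x| ≤ C) →
      ∀ z : X, (∀ U ∈ nhds z, 0 < μstar U) →
        Tendsto (fun n => ∫ y, φ y ∂((kIter P n) z)) atTop (nhds (∫ y, φ y ∂μstar)) := by
    intro φ hφ C hC0 hC z hz
    have hm : Measurable φ := hφ.continuous.measurable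
    have hlocal : ∀ ε : ℝ, 0 < ε → ∀ x : X, ∃ U ∈ nhds x, ∀ y ∈ U, ∀ y' ∈ U,
        asympDist P φ (y, y') ≤ ENNReal.ofReal ε := by
      intro ε hε x
      have hη : 0 < ε / (C + C + 1) := by positivity
      obtain ⟨U, hU, hUΓ⟩ := hΓ_diag _ hη x
      refine ⟨U, hU, fun y hy y' hy' => ?_⟩
      refine (asympDist_le_of_coupling hφ hC (hΓ_cpl y y').1 (hΓ_cpl y y').2
        (hUΓ y hy y' hy')).trans ?_
      rw [← ENNReal.ofReal_mul (by positivity)]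
      refine ENNReal.ofReal_le_ofReal ?_
      rw [mul_div_assoc', div_le_iff₀ (by positivity)]
      nlinarith
    have hae_le : ∀ ε : ℝ, 0 < ε →
        ∀ᵐ p ∂(μstar.prod μstar), asympDist P φ p ≤ ENNReal.ofReal ε := by
      intro ε hε
      obtain ⟨U, hU, hUε⟩ := hlocal ε hε x₀
      obtain ⟨k, -, c, hc, hBc⟩ := hrec (interior U) (interior_mem_nhds.2 hU)
      refine hergodic.ae_le_of_le_on hB_meas hB (measurable_asympDist hm) ENNReal.ofReal_ne_top
        (asympDist_le hC) (asympDist_le_lintegral hm hC)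
        (isOpen_interior.measurableSet.prod isOpen_interior.measurableSet) (k := k)
        (ENNReal.mul_pos hc.ne' hc.ne') (fun p hp => ?_) fun p hp =>
          hUε _ (interior_subset hp.1) _ (interior_subset hp.2)
      rw [Kernel.parallelComp_apply_prod]
      exact mul_le_mul' (hBc _ hp.1) (hBc _ hp.2)
    have hae : ∀ᵐ p ∂(μstar.prod μstar), asympDist P φ p = 0 := by
      have hall : ∀ᵐ p ∂(μstar.prod μstar), ∀ n : ℕ,
          asympDist P φ p ≤ ENNReal.ofReal (1 / ((n : ℝ) + 1)) :=
        ae_all_iff.2 fun n => hae_le _ (by positivity)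
      filter_upwards [hall] with p hp
      have hlim := ENNReal.tendsto_ofReal (tendsto_one_div_add_atTop_nhds_zero_nat (𝕜 := ℝ))
      rw [ENNReal.ofReal_zero] at hlim
      exact le_antisymm (ge_of_tendsto' hlim hp) bot_le
    have hz_le : ∀ ε : ℝ, 0 < ε →
        ∫⁻ y', asympDist P φ (z, y') ∂μstar ≤ ENNReal.ofReal ε := by
      intro ε hε
      obtain ⟨U, hU, hUε⟩ := hlocal ε hε z
      obtain ⟨y, hyU, hy⟩ : ∃ y ∈ U, ∀ᵐ y' ∂μstar, asympDist P φ (y, y') = 0 :=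
        ((frequently_ae_iff.2 (hz U hU).ne').and_eventually
          (Measure.ae_ae_of_ae_prod hae)).exists
      calc ∫⁻ y', asympDist P φ (z, y') ∂μstar ≤ ∫⁻ _, ENNReal.ofReal ε ∂μstar := by
            refine lintegral_mono_ae ?_
            filter_upwards [hy] with y' hy'
            exact (asympDist_le_of_eq_zero hy' z).trans (hUε z (mem_of_mem_nhds hU) y hyU)
        _ = ENNReal.ofReal ε := by simp
    have hlimsup : limsup (fun n => ‖∫ y, φ y ∂(kIter P n z) - ∫ y, φ y ∂μstar‖ₑ) atTop ≤ 0 := by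
      have h1 := limsup_enorm_bind_kIter_le (P := P) hm hC (Measure.dirac z) μstar
      simp_rw [bind_kIter_of_invariant hergodic.1,
        Measure.dirac_bind (Kernel.measurable _)] at h1
      rw [Measure.dirac_prod, lintegral_map (measurable_asympDist hm) measurable_prodMk_left] at h1
      refine ENNReal.le_of_forall_pos_le_add fun ε hε _ => ?_
      rw [zero_add, ← ENNReal.ofReal_coe_nnreal]
      exact h1.trans (hz_le ε hε)
    rw [tendsto_iff_edist_tendsto_0]
    simp_rw [edist_eq_enorm_sub]
    exact tendsto_of_le_liminf_of_limsup_le bot_le hlimsup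
  intro z hz φ
  let laws : ℕ → ProbabilityMeasure X := fun n => ⟨kIter P n z, inferInstance⟩
  let limitLaw : ProbabilityMeasure X := ⟨μstar, inferInstance⟩
  have hweak : Tendsto laws atTop (𝓝 limitLaw) := by
    refine tendsto_iff_forall_lipschitz_integral_tendsto.2 ?_
    rintro ψ ⟨K, hK⟩ ⟨L, hL⟩
    refine main ψ hL.uniformContinuous (|ψ z| + |K|) (by positivity) (fun x => ?_) z hz
    have h1 := hK x z
    rw [Real.dist_eq] at h1
    have h2 := abs_sub_abs_le_abs_sub (ψ x) (ψ z)
    linarith [le_abs_self K]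
  exact ProbabilityMeasure.tendsto_iff_forall_integral_tendsto.1 hweak φ
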